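/- Let μ ∈ (0, 1/2) and let A and B be finite nonempty μ-canonical sets of positive integers. Then there exists a μ-canonical set S with A ∪ B ⊆ S such that S approximates A ⊕ B with factor 1−2μ. Moreover, if A and B are both complete μ-canonical, then S can be chosen to be complete μ-canonical. -/

import Mathlib

open Pointwise

/-- `A ⊕ B = (A + B) ∪ A ∪ B`. -/
def oplus (A B : Finset ℕ) : Finset ℕ := (A + B) ∪ A ∪ B

/-- A finite set of naturals is `μ`-canonical if every element in `[2^i/μ, 2^{i+1}/μ)` is a
multiple of `2^i`. -/
def MuCanonical (μ : ℝ) (S : Finset ℕ) : Prop :=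
  ∀ (i : ℕ), ∀ s ∈ S, (2 : ℝ) ^ i / μ ≤ (s : ℝ) → (s : ℝ) < 2 ^ (i + 1) / μ → 2 ^ i ∣ s

/-- A `μ`-canonical set `S` with `max S ∈ [2^h/μ, 2^{h+1}/μ)` is complete `μ`-canonical if
`S ∩ [2^i/μ, 2^{i+1}/μ) ≠ ∅` for every `i ∈ {1,…,h}`. -/
def CompleteMuCanonical (μ : ℝ) (S : Finset ℕ) : Prop :=
  MuCanonical μ S ∧
  ∃ hne : S.Nonempty, ∀ h : ℕ,
    (2 : ℝ) ^ h / μ ≤ (S.max' hne : ℝ) → ((S.max' hne : ℝ)) < 2 ^ (h + 1) / μ →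
      ∀ i : ℕ, 1 ≤ i → i ≤ h →
        ∃ s ∈ S, (2 : ℝ) ^ i / μ ≤ (s : ℝ) ∧ (s : ℝ) < 2 ^ (i + 1) / μ

/-- `S'` approximates `S` with factor `1-μ`. -/
def ApproxFactor (μ : ℝ) (S S' : Finset ℕ) : Prop :=
  (∀ s ∈ S, ∃ s' ∈ S', (1 - μ) * (s : ℝ) ≤ (s' : ℝ) ∧ (s' : ℝ) ≤ (s : ℝ)) ∧
  (∀ s' ∈ S', ∃ s ∈ S, (s' : ℝ) ≤ (s : ℝ) ∧ (s : ℝ) ≤ (s' : ℝ) / (1 - μ))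

/-- Rounding a natural down to a `μ`-canonical one costs at most a factor `1 - μ`. -/
theorem exists_canonical_le {μ : ℝ} (hμ0 : 0 < μ) (x : ℕ) :
    ∃ y : ℕ, y ≤ x ∧ (1 - μ) * (x : ℝ) ≤ y ∧
      ∀ i : ℕ, (2 : ℝ) ^ i / μ ≤ (y : ℝ) → 2 ^ i ∣ y := by
  rcases lt_or_ge (μ * x) 1 with hx | hx
  · refine ⟨x, le_rfl, ?_, fun i hi => ?_⟩
    · nlinarith [mul_nonneg hμ0.le (Nat.cast_nonneg (α := ℝ) x)]
    · rw [div_le_iff₀ hμ0] at hi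
      have : (1 : ℝ) ≤ 2 ^ i := one_le_pow₀ (by norm_num)
      linarith
  · obtain ⟨k, hk, hk'⟩ := exists_nat_pow_near hx (by norm_num : (1 : ℝ) < 2)
    have hle : x / 2 ^ k * 2 ^ k ≤ x := Nat.div_mul_le_self _ _
    refine ⟨x / 2 ^ k * 2 ^ k, hle, ?_, fun i hi => ?_⟩
    · have h : x < x / 2 ^ k * 2 ^ k + 2 ^ k := Nat.lt_div_mul_add (by positivity)
      have h' : (x : ℝ) < ((x / 2 ^ k * 2 ^ k : ℕ) : ℝ) + 2 ^ k := by exact_mod_cast h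
      linarith
    · rw [div_le_iff₀ hμ0] at hi
      have hle' : ((x / 2 ^ k * 2 ^ k : ℕ) : ℝ) ≤ x := by exact_mod_cast hle
      have hlt : (2 : ℝ) ^ i < 2 ^ (k + 1) := by
        nlinarith [mul_le_mul_of_nonneg_right hle' hμ0.le]
      have hik : i < k + 1 := (pow_lt_pow_iff_right₀ (by norm_num)).1 hlt
      exact (pow_dvd_pow 2 (by omega)).trans (dvd_mul_left _ _)

/-- A complete `μ`-canonical set meets every dyadic interval lying below one of its elements. -/
theorem CompleteMuCanonical.exists_mem {μ : ℝ} (hμ0 : 0 < μ) {S : Finset ℕ}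
    (hS : CompleteMuCanonical μ S) {m : ℕ} (hm : m ∈ S) {i : ℕ} (hi : 1 ≤ i)
    (him : (2 : ℝ) ^ i / μ ≤ m) :
    ∃ s ∈ S, (2 : ℝ) ^ i / μ ≤ (s : ℝ) ∧ (s : ℝ) < 2 ^ (i + 1) / μ := by
  obtain ⟨-, hne, hS⟩ := hS
  have hmax : (m : ℝ) ≤ S.max' hne := by exact_mod_cast S.le_max' m hm
  have hi' : (2 : ℝ) ^ i ≤ S.max' hne * μ := (div_le_iff₀ hμ0).1 (him.trans hmax)
  obtain ⟨k, hk, hk'⟩ := exists_nat_pow_near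
    ((one_le_pow₀ (by norm_num)).trans hi') (by norm_num : (1 : ℝ) < 2)
  have hik : i < k + 1 := (pow_lt_pow_iff_right₀ (by norm_num)).1 (hi'.trans_lt hk')
  exact hS k ((div_le_iff₀ hμ0).2 hk) ((lt_div_iff₀ hμ0).2 hk') i hi (by omega)

theorem stmt13 (μ : ℝ) (hμ0 : 0 < μ) (hμ : μ < 1 / 2)
    (A B : Finset ℕ) (hA : A.Nonempty) (hB : B.Nonempty)
    (hApos : ∀ a ∈ A, 0 < a) (hBpos : ∀ b ∈ B, 0 < b)
    (hAc : MuCanonical μ A) (hBc : MuCanonical μ B) :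
    ∃ S : Finset ℕ, MuCanonical μ S ∧ A ∪ B ⊆ S ∧
      ApproxFactor (2 * μ) (oplus A B) S ∧
      (CompleteMuCanonical μ A → CompleteMuCanonical μ B → CompleteMuCanonical μ S) := by
  choose f hfle hfge hf using exists_canonical_le hμ0
  have hcan : MuCanonical μ ((A + B).image f ∪ (A ∪ B)) := by
    intro i s hs h1 h2
    simp only [Finset.mem_union, Finset.mem_image] at hs
    rcases hs with ⟨x, -, rfl⟩ | hs | hs
    · exact hf x i h1
    · exact hAc i s hs h1 h2
    · exact hBc i s hs h1 h2
  have hfge' (x : ℕ) : (1 - 2 * μ) * (x : ℝ) ≤ f x := by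
    nlinarith [hfge x, mul_nonneg hμ0.le (Nat.cast_nonneg (α := ℝ) x)]
  have hself (x : ℕ) : (1 - 2 * μ) * (x : ℝ) ≤ x := by
    nlinarith [mul_nonneg hμ0.le (Nat.cast_nonneg (α := ℝ) x)]
  have hpos : 0 < 1 - 2 * μ := by linarith
  refine ⟨(A + B).image f ∪ (A ∪ B), hcan, Finset.subset_union_right, ⟨?_, ?_⟩, ?_⟩
  · intro s hs
    rw [oplus, Finset.union_assoc, Finset.mem_union] at hs
    rcases hs with hs | hs
    · exact ⟨f s, Finset.mem_union_left _ (Finset.mem_image_of_mem f hs), hfge' s,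
        by exact_mod_cast hfle s⟩
    · exact ⟨s, Finset.mem_union_right _ hs, hself s, le_rfl⟩
  · intro s hs
    rw [oplus, Finset.union_assoc]
    rcases Finset.mem_union.1 hs with hs | hs
    · obtain ⟨x, hx, rfl⟩ := Finset.mem_image.1 hs
      refine ⟨x, Finset.mem_union_left _ hx, by exact_mod_cast hfle x, ?_⟩
      rw [le_div_iff₀ hpos, mul_comm]
      exact hfge' x
    · refine ⟨s, Finset.mem_union_right _ hs, le_rfl, ?_⟩
      rw [le_div_iff₀ hpos, mul_comm]
      exact hself s
  · intro hAC hBC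
    have hne : ((A + B).image f ∪ (A ∪ B)).Nonempty :=
      (hA.mono Finset.subset_union_left).mono Finset.subset_union_right
    refine ⟨hcan, hne, fun h hh hh' i hi hih => ?_⟩
    have hmem := Finset.max'_mem _ hne
    rcases hih.eq_or_lt with rfl | hlt
    · exact ⟨_, hmem, hh, hh'⟩
    have hstep : 2 * ((2 : ℝ) ^ i / μ) ≤ 2 ^ h / μ := by
      rw [← mul_div_assoc, ← pow_succ']
      gcongr
      · norm_num
      · exact hlt
    have h0 : 0 < (2 : ℝ) ^ i / μ := by positivity
    have key : ∃ m : ℕ, (m ∈ A ∨ m ∈ B) ∧ (2 : ℝ) ^ i / μ ≤ m := by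
      rcases Finset.mem_union.1 hmem with hm | hm
      · obtain ⟨x, hx, hfx⟩ := Finset.mem_image.1 hm
        obtain ⟨a, ha, b, hb, rfl⟩ := Finset.mem_add.1 hx
        have hab : (f (a + b) : ℝ) ≤ a + b := by exact_mod_cast hfle (a + b)
        rw [← hfx] at hh
        rcases le_total (a : ℝ) b with hle | hle
        · exact ⟨b, Or.inr hb, by linarith⟩
        · exact ⟨a, Or.inl ha, by linarith⟩
      · exact ⟨_, Finset.mem_union.1 hm, by linarith⟩
    obtain ⟨m, hm | hm, him⟩ := key
    · obtain ⟨s, hs, hs'⟩ := hAC.exists_mem hμ0 hm hi him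
      exact ⟨s, Finset.mem_union_right _ (Finset.mem_union_left _ hs), hs'⟩
    · obtain ⟨s, hs, hs'⟩ := hBC.exists_mem hμ0 hm hi him
      exact ⟨s, Finset.mem_union_right _ (Finset.mem_union_right _ hs), hs'⟩
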